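/- (Discrepancy form of the Disjointness lower bound.) Let k ≥ 2 and m ≥ 1 be integers, let NOR_m : {0,1}^m → {−1,1} be given by NOR_m(z) = 1 if z = 0^m and −1 otherwise, and let d be the 1/3-approximate degree of NOR_m; assume d > 2. Let ℓ be an integer with ℓ − 1 ≥ 2^{2^k}(k−1)e·m/d (e being Euler's number) and n = ℓ^{k−1}m. Then there exist a probability distribution λ' on ({0,1}^n)^k and a function h : ({0,1}^n)^k → {−1,1} such that Corr_{λ'}(DISJ_k, h) > 1/3 and disc_{k,λ'}(h) ≤ 2^{−d/2^{k−1}}. -/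

import Mathlib

open scoped BigOperators

/-- A `k`-cylinder in the `i`-th dimension: its value does not depend on the
`i`-th coordinate. -/
def IsCylinder {k : ℕ} {W : Type*} (i : Fin k) (ψ : (Fin k → W) → Bool) : Prop :=
  ∀ y y' : Fin k → W, (∀ j, j ≠ i → y j = y' j) → ψ y = ψ y'

/-- A cylinder intersection: the pointwise product of cylinders in dimensions `1,…,k`. -/
def IsCylinderIntersection {k : ℕ} {W : Type*} (φ : (Fin k → W) → Bool) : Prop :=
  ∃ ψ : Fin k → ((Fin k → W) → Bool),
    (∀ i, IsCylinder i (ψ i)) ∧ ∀ y, φ y = decide (∀ i, ψ i y = true)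

/-- Interpret a boolean as the real `0` or `1`. -/
noncomputable def bval (b : Bool) : ℝ := if b then 1 else 0

/-- A probability distribution on a finite set. -/
def IsProbDist {D : Type*} [Fintype D] (μ : D → ℝ) : Prop :=
  (∀ x, 0 ≤ μ x) ∧ ∑ x, μ x = 1

/-- `disc_{k,λ}(h)`: the supremum over cylinder intersections `φ` of
`|E_{y∼λ}[h(y)φ(y)]|`. -/
noncomputable def disc {k : ℕ} {W : Type*} [Fintype W]
    (lam : (Fin k → W) → ℝ) (h : (Fin k → W) → ℝ) : ℝ :=
  sSup { t | ∃ φ, IsCylinderIntersection φ ∧ t = |∑ y, lam y * h y * bval (φ y)| }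

/-- The `k`-party Disjointness function on `({0,1}^n)^k`, with values in `{-1,1}`:
`-1` iff some index `j` has `y^1_j = ⋯ = y^k_j = 1`. -/
noncomputable def DISJ (k n : ℕ) (y : Fin k → Fin n → Bool) : ℝ :=
  if ∃ j : Fin n, ∀ i : Fin k, y i j = true then -1 else 1

/-- `NOR_m : {0,1}^m → {-1,1}`: `1` if `z = 0^m` and `-1` otherwise. -/
noncomputable def NOR (m : ℕ) (z : Fin m → Bool) : ℝ :=
  if ∀ i, z i = false then 1 else -1

/-- The character `χ_S(x) = (-1)^{Σ_{i∈S} x_i}`. -/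
noncomputable def chiChar {m : ℕ} (S : Finset (Fin m)) (z : Fin m → Bool) : ℝ :=
  ∏ i ∈ S, (if z i then (-1 : ℝ) else 1)

/-- `φ : {0,1}^m → ℝ` is (the evaluation of) a multilinear real polynomial of degree
at most `d`: a linear combination of the characters `χ_S` with `|S| ≤ d`. -/
def DegLE (m d : ℕ) (φ : (Fin m → Bool) → ℝ) : Prop :=
  ∃ c : Finset (Fin m) → ℝ,
    ∀ z, φ z = ∑ S ∈ Finset.univ.filter (fun S : Finset (Fin m) => S.card ≤ d),
      c S * chiChar S z

/-- The `δ`-approximate degree of `f`: the least `d` such that some multilinear real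
polynomial `φ` of degree at most `d` satisfies `|f(x) − φ(x)| ≤ δ` for all `x`. -/
noncomputable def approxDeg (m : ℕ) (δ : ℝ) (f : (Fin m → Bool) → ℝ) : ℕ :=
  sInf { d | ∃ φ, DegLE m d φ ∧ ∀ z, |f z - φ z| ≤ δ }

open Finset

lemma expect_prod_type {α β : Type*} [Fintype α] [Fintype β] (f : α × β → ℝ) :
    𝔼 p : α × β, f p = 𝔼 a, 𝔼 b, f (a, b) := by
  rw [← Finset.univ_product_univ, Finset.expect_product]

lemma expect_cons {T : Type*} [Fintype T] (K : ℕ) (f : (Fin (K+1) → T) → ℝ) :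
    𝔼 S, f S = 𝔼 s : T, 𝔼 S : Fin K → T, f (Fin.cons s S) := by
  rw [← expect_prod_type (fun p : T × (Fin K → T) => f (Fin.cons p.1 p.2))]
  exact (Fintype.expect_equiv (Fin.consEquiv (fun _ => T)) _ _ (fun p => rfl)).symm

lemma cs_aux {α : Type*} [Fintype α] [Nonempty α] (c H : α → ℝ) (hc : ∀ a, |c a| ≤ 1) :
    (𝔼 a, c a * H a) ^ 2 ≤ 𝔼 a, H a ^ 2 := by
  refine (Finset.expect_mul_sq_le_sq_mul_sq _ _ _).trans ?_
  have h1 : 𝔼 a, c a ^ 2 ≤ (1 : ℝ) := by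
    refine Finset.expect_le Finset.univ_nonempty fun a _ => ?_
    rw [← sq_abs]
    exact pow_le_one₀ (abs_nonneg _) (hc a)
  have h2 : 0 ≤ 𝔼 a, H a ^ 2 := Finset.expect_nonneg fun a _ => sq_nonneg _
  nlinarith

lemma jensen_pow {α : Type*} [Fintype α] [Nonempty α] (b : α → ℝ) (K : ℕ) :
    (𝔼 a, b a) ^ (2 ^ K) ≤ 𝔼 a, |b a| ^ (2 ^ K) := by
  induction K generalizing b with
  | zero => simpa using (le_abs_self _).trans (Finset.abs_expect_le _ _)
  | succ K ih =>
    have h := cs_aux (fun _ : α => (1:ℝ)) b (by simp)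
    simp only [one_mul] at h
    rw [pow_succ' 2 K, pow_mul]
    refine (pow_le_pow_left₀ (sq_nonneg _) h _).trans ((ih _).trans (le_of_eq ?_))
    refine Finset.expect_congr rfl fun a _ => ?_
    rw [abs_pow, ← pow_mul]

theorem bns {X T : Type*} [Fintype X] [Nonempty X] [Fintype T] [Nonempty T] (K : ℕ) :
    ∀ (F : X → (Fin K → T) → ℝ) (φ0 : (Fin K → T) → ℝ) (φ : Fin K → X → (Fin K → T) → ℝ),
    (∀ S, |φ0 S| ≤ 1) → (∀ i x S, |φ i x S| ≤ 1) →
    (∀ i x S S', (∀ j, j ≠ i → S j = S' j) → φ i x S = φ i x S') →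
    |𝔼 S, 𝔼 x, F x S * φ0 S * ∏ i, φ i x S| ^ (2 ^ K) ≤
      𝔼 P : Fin K → T × T, |𝔼 x, ∏ u : Fin K → Bool,
        F x (fun i => if u i then (P i).2 else (P i).1)| := by
  induction K with
  | zero =>
    intro F φ0 φ h0 h1 h2
    simp only [Finset.univ_eq_empty, Finset.prod_empty, mul_one, pow_zero, pow_one]
    rw [Fintype.expect_eq_sum_div_card, Fintype.expect_eq_sum_div_card]
    simp only [Fintype.sum_unique, Fintype.card_unique, Nat.cast_one, div_one, Fintype.prod_unique]
    rw [← Finset.expect_mul, abs_mul]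
    refine (mul_le_of_le_one_right (abs_nonneg _) (h0 _)).trans (le_of_eq ?_)
    congr 1
    refine Finset.expect_congr rfl fun x _ => ?_
    congr 1
    exact Subsingleton.elim _ _
  | succ K ih =>
    intro F φ0 φ h0 h1 h2
    obtain ⟨s0⟩ := (inferInstance : Nonempty T)
    set H : (Fin K → T) × X → T → ℝ := fun p s => F p.2 (Fin.cons s p.1) * φ0 (Fin.cons s p.1) *
        ∏ i : Fin K, φ i.succ p.2 (Fin.cons s p.1) with hH
    have e1 : 𝔼 S, 𝔼 x, F x S * φ0 S * ∏ i, φ i x S =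
        𝔼 p : (Fin K → T) × X, φ 0 p.2 (Fin.cons s0 p.1) * 𝔼 s, H p s := by
      rw [expect_prod_type, expect_cons, Finset.expect_comm]
      refine Finset.expect_congr rfl fun S _ => ?_
      rw [Finset.expect_comm]
      refine Finset.expect_congr rfl fun x _ => ?_
      rw [Finset.mul_expect]
      refine Finset.expect_congr rfl fun s _ => ?_
      rw [Fin.prod_univ_succ]
      have : φ 0 x (Fin.cons s S) = φ 0 x (Fin.cons s0 S) := by
        refine h2 0 x _ _ fun j hj => ?_
        obtain ⟨j, rfl⟩ := Fin.exists_succ_eq.2 hj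
        simp
      rw [this, hH]
      ring
    set b : T × T → ℝ := fun q => 𝔼 S : Fin K → T, 𝔼 x,
      (F x (Fin.cons q.1 S) * F x (Fin.cons q.2 S)) *
      (φ0 (Fin.cons q.1 S) * φ0 (Fin.cons q.2 S)) *
      ∏ i : Fin K, (φ i.succ x (Fin.cons q.1 S) * φ i.succ x (Fin.cons q.2 S)) with hb
    have e2 : 𝔼 p, (𝔼 s, H p s) ^ 2 = 𝔼 q, b q := by
      rw [expect_prod_type]
      have : ∀ S x, (𝔼 s, H (S, x) s) ^ 2 = 𝔼 q : T × T, H (S, x) q.1 * H (S, x) q.2 := by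
        intro S x
        rw [sq, Finset.expect_mul_expect, expect_prod_type]
      simp only [this]
      simp only [hb]
      rw [Finset.expect_comm (s := (univ : Finset (T × T)))]
      refine Finset.expect_congr rfl fun S _ => ?_
      rw [Finset.expect_comm]
      refine Finset.expect_congr rfl fun q _ => ?_
      refine Finset.expect_congr rfl fun x _ => ?_
      rw [Finset.prod_mul_distrib, hH]
      ring
    have e3 : (𝔼 S, 𝔼 x, F x S * φ0 S * ∏ i, φ i x S) ^ 2 ≤ 𝔼 q, b q := by
      rw [e1, ← e2]
      exact cs_aux _ _ fun p => h1 _ _ _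
    rw [pow_succ' 2 K, pow_mul, sq_abs]
    refine (pow_le_pow_left₀ (sq_nonneg _) e3 _).trans ((jensen_pow b K).trans ?_)
    rw [expect_cons]
    refine Finset.expect_le_expect fun q _ => ?_
    refine (ih (fun x S => F x (Fin.cons q.1 S) * F x (Fin.cons q.2 S))
      (fun S => φ0 (Fin.cons q.1 S) * φ0 (Fin.cons q.2 S))
      (fun i x S => φ i.succ x (Fin.cons q.1 S) * φ i.succ x (Fin.cons q.2 S)) ?_ ?_ ?_).trans
        (le_of_eq ?_)
    · intro S
      rw [abs_mul]
      exact mul_le_one₀ (h0 _) (abs_nonneg _) (h0 _)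
    · intro i x S
      rw [abs_mul]
      exact mul_le_one₀ (h1 _ _ _) (abs_nonneg _) (h1 _ _ _)
    · intro i x S S' hS
      have : ∀ t : T, φ i.succ x (Fin.cons t S) = φ i.succ x (Fin.cons t S') := by
        intro t
        refine h2 _ _ _ _ fun j hj => ?_
        induction j using Fin.cases with
        | zero => simp
        | succ j =>
          simp only [Fin.cons_succ]
          exact hS j fun h => hj (by rw [h])
      simp only [this]
    · refine Finset.expect_congr rfl fun P _ => ?_
      congr 1
      refine Finset.expect_congr rfl fun x _ => ?_
      rw [← Equiv.prod_comp (Fin.consEquiv (fun _ => Bool)), Fintype.prod_prod_type]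
      rw [Finset.prod_comm]
      refine Finset.prod_congr rfl fun u _ => ?_
      rw [Fintype.prod_bool, mul_comm]
      congr 2
      · funext i
        induction i using Fin.cases <;> simp [Fin.consEquiv]
      · funext i
        induction i using Fin.cases <;> simp [Fin.consEquiv]

theorem duality (m d : ℕ) (f : (Fin m → Bool) → ℝ) (δ : ℝ) (hδ : 0 ≤ δ)
    (hno : ¬ ∃ φ, DegLE m d φ ∧ ∀ z, |f z - φ z| ≤ δ) :
    ∃ G : (Fin m → Bool) → ℝ, ∑ z, |G z| = 1 ∧ δ < ∑ z, f z * G z ∧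
      ∀ S : Finset (Fin m), S.card ≤ d → ∑ z, G z * chiChar S z = 0 := by
  classical
  set V : Submodule ℝ ((Fin m → Bool) → ℝ) :=
    Submodule.span ℝ ((fun S : Finset (Fin m) => chiChar S) '' {S | S.card ≤ d}) with hV
  have hVdeg : ∀ φ ∈ V, DegLE m d φ := by
    intro φ hφ
    induction hφ using Submodule.span_induction with
    | mem x hx =>
      obtain ⟨S, hS, rfl⟩ := hx
      refine ⟨fun S' => if S' = S then 1 else 0, fun z => ?_⟩
      have hS' : S.card ≤ d := hS
      simp [Finset.sum_ite_eq', hS']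
    | zero => exact ⟨fun _ => 0, by simp⟩
    | add x y _ _ hx hy =>
      obtain ⟨a, ha⟩ := hx
      obtain ⟨b, hb⟩ := hy
      refine ⟨fun S => a S + b S, fun z => ?_⟩
      simp only [Pi.add_apply, ha, hb, add_mul, Finset.sum_add_distrib]
    | smul t x _ hx =>
      obtain ⟨a, ha⟩ := hx
      refine ⟨fun S => t * a S, fun z => ?_⟩
      simp only [Pi.smul_apply, ha, smul_eq_mul, Finset.mul_sum, mul_assoc]
  have hdisj : Disjoint (Metric.closedBall f δ) (V : Set ((Fin m → Bool) → ℝ)) := by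
    rw [Set.disjoint_left]
    intro φ hφ hφV
    refine hno ⟨φ, hVdeg φ hφV, fun z => ?_⟩
    rw [Metric.mem_closedBall, dist_comm] at hφ
    have := (dist_le_pi_dist f φ z).trans hφ
    rwa [Real.dist_eq] at this
  obtain ⟨L, u, v, hu, huv, hv⟩ := geometric_hahn_banach_compact_closed
    (convex_closedBall f δ) (isCompact_closedBall f δ) V.convex V.closed_of_finiteDimensional hdisj
  have hv0 : v < 0 := by simpa using hv 0 V.zero_mem
  have hLV : ∀ φ ∈ V, L φ = 0 := by
    intro φ hφ
    by_contra hne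
    have := hv ((v / L φ) • φ) (V.smul_mem _ hφ)
    rw [map_smul, smul_eq_mul, div_mul_cancel₀ _ hne] at this
    exact lt_irrefl _ this
  set ψ : (Fin m → Bool) → ℝ := fun z => L (Pi.single z 1) with hψ
  have hL : ∀ φ : (Fin m → Bool) → ℝ, L φ = ∑ z, φ z * ψ z := by
    intro φ
    conv_lhs => rw [pi_eq_sum_univ' φ]
    rw [map_sum]
    refine Finset.sum_congr rfl fun z _ => ?_
    rw [map_smul, smul_eq_mul, hψ]
  set a : (Fin m → Bool) → ℝ := fun z => f z + δ * SignType.sign (ψ z) with ha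
  have hmem : a ∈ Metric.closedBall f δ := by
    rw [Metric.mem_closedBall, dist_pi_le_iff hδ]
    intro z
    rw [Real.dist_eq, ha]
    simp only [add_sub_cancel_left]
    rw [abs_mul, abs_of_nonneg hδ]
    refine mul_le_of_le_one_right hδ ?_
    rcases lt_trichotomy (ψ z) 0 with h | h | h <;> simp [h]
  have hlt : ∑ z, f z * ψ z + δ * ∑ z, |ψ z| < 0 := by
    have h1 := (hu a hmem).trans (huv.trans hv0)
    rw [hL] at h1
    refine lt_of_eq_of_lt ?_ h1
    rw [Finset.mul_sum, ← Finset.sum_add_distrib]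
    refine Finset.sum_congr rfl fun z _ => ?_
    rw [ha]
    simp only
    rw [add_mul, mul_assoc, sign_mul_self]
  set N := ∑ z, |ψ z| with hN
  have hNpos : 0 < N := by
    rcases (Finset.sum_nonneg fun z _ => abs_nonneg (ψ z) : 0 ≤ N).lt_or_eq with h | h
    · exact h
    · exfalso
      have h0 : ∀ z, ψ z = 0 := by
        intro z
        have := (Finset.sum_eq_zero_iff_of_nonneg fun z _ => abs_nonneg (ψ z)).1 h.symm z
          (Finset.mem_univ _)
        simpa using this
      simp [hN, h0] at hlt
  refine ⟨fun z => -ψ z / N, ?_, ?_, ?_⟩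
  · simp only [abs_div, abs_neg, abs_of_pos hNpos]
    rw [← Finset.sum_div, ← hN, div_self hNpos.ne']
  · have : ∑ z, f z * (-ψ z / N) = -(∑ z, f z * ψ z) / N := by
      rw [← Finset.sum_neg_distrib, Finset.sum_div]
      refine Finset.sum_congr rfl fun z _ => by ring
    rw [this, lt_div_iff₀ hNpos]
    linarith
  · intro S hS
    have h := hLV (chiChar S) (Submodule.subset_span ⟨S, hS, rfl⟩)
    rw [hL] at h
    have : ∑ z, -ψ z / N * chiChar S z = -(∑ z, chiChar S z * ψ z) / N := by
      rw [← Finset.sum_neg_distrib, Finset.sum_div]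
      refine Finset.sum_congr rfl fun z _ => by ring
    rw [this, h]
    simp

lemma expect_comp_inj {U P : Type*} [Fintype U] [Fintype P] [DecidableEq U] [DecidableEq P]
    (p : U → P) (hp : Function.Injective p) (f : (U → Bool) → ℝ) :
    𝔼 x : P → Bool, f (fun u => x (p u)) = 𝔼 w, f w := by
  have h1 : ∀ w : U → Bool, 𝔼 x : P → Bool, f (fun u => x (p u)) =
      𝔼 x : P → Bool, f (fun u => xor (x (p u)) (w u)) := by
    intro w
    have hinv : Function.Involutive
        (fun (x : P → Bool) a => xor (x a) (Function.extend p w (fun _ => false) a)) := by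
      intro x
      funext a
      simp
    refine (Fintype.expect_equiv hinv.toPerm _ _ fun x => ?_).symm
    congr 1
    funext u
    simp [Function.Involutive.toPerm, hp.extend_apply]
  have h2 : ∀ x : P → Bool, 𝔼 w : U → Bool, f (fun u => xor (x (p u)) (w u)) = 𝔼 w, f w := by
    intro x
    have hinv : Function.Involutive (fun (w : U → Bool) u => xor (x (p u)) (w u)) := by
      intro w
      funext a
      simp
    exact Fintype.expect_equiv hinv.toPerm _ _ fun x => rfl
  calc 𝔼 x : P → Bool, f (fun u => x (p u))
      = 𝔼 w : U → Bool, 𝔼 x : P → Bool, f (fun u => x (p u)) := (Fintype.expect_const _).symm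
    _ = 𝔼 w : U → Bool, 𝔼 x : P → Bool, f (fun u => xor (x (p u)) (w u)) :=
        Finset.expect_congr rfl fun w _ => h1 w
    _ = 𝔼 x : P → Bool, 𝔼 w : U → Bool, f (fun u => xor (x (p u)) (w u)) := Finset.expect_comm _ _ _
    _ = 𝔼 x : P → Bool, 𝔼 w, f w := Finset.expect_congr rfl fun x _ => h2 x
    _ = _ := Fintype.expect_const _

lemma junta_orth {m d : ℕ} (G : (Fin m → Bool) → ℝ)
    (hG : ∀ S : Finset (Fin m), S.card ≤ d → ∑ z, G z * chiChar S z = 0)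
    (J : Finset (Fin m)) (hJ : J.card ≤ d) (H : (Fin m → Bool) → ℝ)
    (hH : ∀ w w', (∀ j ∈ J, w j = w' j) → H w = H w') :
    ∑ w, G w * H w = 0 := by
  have key : ∀ v : Fin m → Bool,
      ∑ w, G w * (if ∀ j ∈ J, w j = v j then (1 : ℝ) else 0) = 0 := by
    intro v
    have e : ∀ w : Fin m → Bool, (if ∀ j ∈ J, w j = v j then (1 : ℝ) else 0) =
        ∑ S ∈ J.powerset, (∏ j ∈ S, (if v j then (-1 : ℝ) else 1)) * (1 / 2) ^ J.card *
          chiChar S w := by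
      intro w
      have : (if ∀ j ∈ J, w j = v j then (1 : ℝ) else 0) =
          ∏ j ∈ J, ((1 / 2) * ((if v j then (-1 : ℝ) else 1) * (if w j then (-1 : ℝ) else 1) + 1)) := by
        trans ∏ j ∈ J, if w j = v j then (1 : ℝ) else 0
        · rw [Finset.prod_boole]
          congr
        refine Finset.prod_congr rfl fun j _ => ?_
        cases w j <;> cases v j <;> norm_num
      rw [this, Finset.prod_mul_distrib, Finset.prod_const, Finset.prod_add, Finset.mul_sum]
      refine Finset.sum_congr rfl fun S _ => ?_
      rw [Finset.prod_mul_distrib, Finset.prod_const_one, chiChar]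
      ring
    simp only [e, Finset.mul_sum]
    rw [Finset.sum_comm]
    refine Finset.sum_eq_zero fun S hS => ?_
    have hc : S.card ≤ d := (Finset.card_le_card (Finset.mem_powerset.1 hS)).trans hJ
    have := hG S hc
    calc _ = ∑ w, ((∏ j ∈ S, (if v j then (-1 : ℝ) else 1)) * (1 / 2) ^ J.card) *
          (G w * chiChar S w) := Finset.sum_congr rfl fun w _ => by ring
      _ = 0 := by rw [← Finset.mul_sum, this, mul_zero]
  have e2 : ∀ w, H w = ∑ v ∈ univ.filter (fun v : Fin m → Bool => ∀ j, j ∉ J → v j = false),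
      H v * (if ∀ j ∈ J, w j = v j then (1 : ℝ) else 0) := by
    intro w
    set v0 : Fin m → Bool := fun j => if j ∈ J then w j else false with hv0
    rw [Finset.sum_eq_single v0]
    · have : ∀ j ∈ J, w j = v0 j := fun j hj => by simp [hv0, hj]
      rw [if_pos this, mul_one]
      exact hH _ _ this
    · intro v hv hne
      rw [if_neg, mul_zero]
      intro h
      apply hne
      funext j
      by_cases hj : j ∈ J
      · simp [hv0, hj, h j hj]
      · simp [hv0, hj, (Finset.mem_filter.1 hv).2 j hj]
    · intro h
      exfalso
      apply h
      simp only [Finset.mem_filter, Finset.mem_univ, true_and]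
      intro j hj
      simp [hv0, hj]
  calc ∑ w, G w * H w = ∑ w, ∑ v ∈ univ.filter (fun v : Fin m → Bool => ∀ j, j ∉ J → v j = false),
      H v * (G w * (if ∀ j ∈ J, w j = v j then (1 : ℝ) else 0)) := by
        refine Finset.sum_congr rfl fun w _ => ?_
        rw [e2 w, Finset.mul_sum]
        refine Finset.sum_congr rfl fun v _ => by ring
    _ = 0 := by
        rw [Finset.sum_comm]
        refine Finset.sum_eq_zero fun v _ => ?_
        rw [← Finset.mul_sum, key, mul_zero]

lemma claim_one {m d : ℕ} {P : Type*} [Fintype P] [DecidableEq P] (G : (Fin m → Bool) → ℝ)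
    (hG : ∀ S : Finset (Fin m), S.card ≤ d → ∑ z, G z * chiChar S z = 0)
    (J : Finset (Fin m)) (hJ : J.card ≤ d) (q : Fin m → P) (hq : Function.Injective q)
    (R : (P → Bool) → ℝ)
    (hR : ∀ x x' : P → Bool, (∀ a, (∀ j, j ∉ J → a ≠ q j) → x a = x' a) → R x = R x') :
    𝔼 x : P → Bool, G (fun j => x (q j)) * R x = 0 := by
  have e : ∀ x : P → Bool, G (fun j => x (q j)) * R x =
      ∑ w, G w * (R x * if (fun j => x (q j)) = w then 1 else 0) := by
    intro x
    simp
  simp only [e]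
  rw [Finset.expect_sum_comm]
  simp only [← Finset.mul_expect]
  refine junta_orth G hG J hJ _ ?_
  intro w w' hw
  have hinv : Function.Involutive (fun (x : P → Bool) a =>
      xor (x a) (Function.extend q (fun j => xor (w j) (w' j)) (fun _ => false) a)) := by
    intro x
    funext a
    simp
  refine Fintype.expect_equiv hinv.toPerm _ _ fun x => ?_
  simp only [Function.Involutive.toPerm, Equiv.coe_fn_mk]
  congr 1
  · refine hR _ _ fun a ha => ?_
    by_cases h : ∃ j, q j = a
    · obtain ⟨j, rfl⟩ := h
      rw [hq.extend_apply]
      have : j ∈ J := by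
        by_contra hj
        exact ha j hj rfl
      simp [hw j this]
    · rw [Function.extend_apply' _ _ _ h]
      simp
  · simp only [hq.extend_apply]
    congr 1
    simp only [funext_iff, eq_iff_iff]
    refine forall_congr' fun j => ?_
    cases x (q j) <;> cases w j <;> cases w' j <;> simp

lemma claim_two {m : ℕ} {P U : Type*} [Fintype P] [DecidableEq P] [Fintype U] [DecidableEq U]
    (G : (Fin m → Bool) → ℝ) (hG : ∑ z, |G z| = 1)
    (J : Finset (Fin m)) (pos : U → Fin m → P)
    (hpos : ∀ u u' j j', j ∉ J → pos u j = pos u' j' → u = u' ∧ j = j') :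
    |𝔼 x : P → Bool, ∏ u, G (fun j => x (pos u j))| ≤
      (1 / 2) ^ (Fintype.card U * (m - J.card)) := by
  refine (Finset.abs_expect_le _ _).trans ?_
  simp only [Finset.abs_prod]
  have e : ∀ x : P → Bool, ∏ u, |G (fun j => x (pos u j))| =
      ∑ Z : U → Fin m → Bool, (∏ u, |G (Z u)|) *
        if (fun u j => x (pos u j)) = Z then 1 else 0 := by
    intro x
    simp
  simp only [e]
  rw [Finset.expect_sum_comm]
  simp only [← Finset.mul_expect]
  have hb : ∀ Z : U → Fin m → Bool,
      𝔼 x : P → Bool, (if (fun u j => x (pos u j)) = Z then (1 : ℝ) else 0) ≤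
      (1 / 2) ^ (Fintype.card U * (m - J.card)) := by
    intro Z
    have h1 := expect_comp_inj (P := P) (U := U × {j // j ∉ J}) (fun a => pos a.1 a.2.1) (by
      rintro ⟨u, j, hj⟩ ⟨u', j', hj'⟩ h
      obtain ⟨rfl, rfl⟩ := hpos u u' j j' hj h
      rfl) (fun w => if w = (fun a => Z a.1 a.2.1) then (1 : ℝ) else 0)
    have h2 : 𝔼 w : U × {j // j ∉ J} → Bool, (if w = (fun a => Z a.1 a.2.1) then (1 : ℝ) else 0)
        = (1 / 2) ^ (Fintype.card U * (m - J.card)) := by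
      rw [Fintype.expect_eq_sum_div_card]
      simp [Fintype.card_subtype_compl]
    rw [← h2, ← h1]
    refine Finset.expect_le_expect fun x _ => ?_
    split_ifs with ha hb hb
    · exact le_rfl
    · exfalso
      apply hb
      funext a
      rw [← ha]
    · exact zero_le_one
    · exact le_rfl
  calc _ ≤ ∑ Z : U → Fin m → Bool, (∏ u, |G (Z u)|) * (1 / 2) ^ (Fintype.card U * (m - J.card)) := by
        refine Finset.sum_le_sum fun Z _ => ?_
        exact mul_le_mul_of_nonneg_left (hb Z) (Finset.prod_nonneg fun u _ => abs_nonneg _)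
    _ = _ := by
        have h3 := Finset.prod_univ_sum (fun _ : U => (univ : Finset (Fin m → Bool)))
          (fun _ z => |G z|)
        rw [Fintype.piFinset_univ] at h3
        rw [← Finset.sum_mul, ← h3]
        simp [hG]

/-- The set of blocks where two selectors collide on some axis. -/
def badSet {K m ℓ : ℕ} (Q : Fin K → (Fin m → Fin ℓ) × (Fin m → Fin ℓ)) : Finset (Fin m) :=
  univ.filter fun j => ∃ i, (Q i).1 j = (Q i).2 j

lemma pair_bound {K m ℓ d : ℕ} (G : (Fin m → Bool) → ℝ) (hG1 : ∑ z, |G z| = 1)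
    (hG : ∀ S : Finset (Fin m), S.card ≤ d → ∑ z, G z * chiChar S z = 0)
    (Q : Fin K → (Fin m → Fin ℓ) × (Fin m → Fin ℓ)) :
    |𝔼 x : Fin m × (Fin K → Fin ℓ) → Bool, ∏ u : Fin K → Bool,
      (2 ^ m * G (fun j => x (j, fun i => (if u i then (Q i).2 else (Q i).1) j)))| ≤
    if (badSet Q).card ≤ d then 0 else (2 ^ 2 ^ K) ^ (badSet Q).card := by
  set pos : (Fin K → Bool) → Fin m → Fin m × (Fin K → Fin ℓ) :=
    fun u j => (j, fun i => (if u i then (Q i).2 else (Q i).1) j) with hpos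
  have hinj : ∀ u u' j j', j ∉ badSet Q → pos u j = pos u' j' → u = u' ∧ j = j' := by
    intro u u' j j' hj h
    simp only [hpos, Prod.mk.injEq] at h
    obtain ⟨rfl, h⟩ := h
    refine ⟨?_, rfl⟩
    funext i
    have h1 := congrFun h i
    have h2 : (Q i).1 j ≠ (Q i).2 j := by
      intro h3
      exact hj (by simp only [badSet, Finset.mem_filter, Finset.mem_univ, true_and]; exact ⟨i, h3⟩)
    cases hu : u i <;> cases hu' : u' i <;> simp [hu, hu'] at h1 ⊢
    · exact h2 h1
    · exact h2 h1.symm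
  have hJm : (badSet Q).card ≤ m := by simpa using Finset.card_le_univ (badSet Q)
  simp only [Finset.prod_mul_distrib]
  rw [← Finset.mul_expect, abs_mul]
  split_ifs with hc
  · have h0 : 𝔼 x : Fin m × (Fin K → Fin ℓ) → Bool, ∏ u, G (fun j => x (pos u j)) = 0 := by
      set u0 : Fin K → Bool := fun _ => false
      simp only [← Finset.mul_prod_erase univ _ (Finset.mem_univ u0)]
      refine claim_one G hG (badSet Q) hc (pos u0) ?_
        (fun x => ∏ u ∈ univ.erase u0, G (fun j => x (pos u j))) ?_
      · intro j j' h
        exact congrArg Prod.fst h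
      · intro x x' hx
        refine Finset.prod_congr rfl fun u hu => ?_
        congr 1
        funext j
        refine hx _ fun j' hj' h => ?_
        exact (Finset.mem_erase.1 hu).1 (hinj _ _ _ _ hj' h.symm).1.symm
    rw [h0]
    simp
  · have h1 := claim_two G hG1 (badSet Q) pos hinj
    refine (mul_le_mul_of_nonneg_left h1 (abs_nonneg _)).trans (le_of_eq ?_)
    simp only [Finset.prod_const, Finset.card_univ, Fintype.card_fun, Fintype.card_bool,
      Fintype.card_fin]
    rw [abs_of_nonneg (by positivity), ← pow_mul, ← pow_mul]
    obtain ⟨r, hr⟩ := Nat.exists_eq_add_of_le hJm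
    generalize (badSet Q).card = s at *
    subst hr
    rw [Nat.add_sub_cancel_left, add_mul, pow_add, one_div, inv_pow, mul_comm r, mul_assoc,
      mul_inv_cancel₀ (by positivity), mul_one, mul_comm s]

lemma expect_prod_pi {ι κ : Type*} [Fintype ι] [DecidableEq ι] [Fintype κ] (g : ι → κ → ℝ) :
    𝔼 f : ι → κ, ∏ i, g i (f i) = ∏ i, 𝔼 k, g i k := by
  simp only [Fintype.expect_eq_sum_div_card]
  rw [Finset.prod_div_distrib, Finset.prod_univ_sum, Fintype.piFinset_univ]
  simp

lemma mgf {K m ℓ : ℕ} (hl : 0 < ℓ) (c : ℝ) :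
    𝔼 Q : Fin K → (Fin m → Fin ℓ) × (Fin m → Fin ℓ), ∏ i, ∏ j,
      (if (Q i).1 j = (Q i).2 j then c else 1) = ((1 + (c - 1) / ℓ) ^ m) ^ K := by
  have : Nonempty (Fin ℓ) := ⟨⟨0, hl⟩⟩
  rw [expect_prod_pi (ι := Fin K) (κ := (Fin m → Fin ℓ) × (Fin m → Fin ℓ))
    (fun _ q => ∏ j, (if q.1 j = q.2 j then c else 1))]
  have h1 : ∀ a : Fin ℓ, 𝔼 b : Fin ℓ, (if a = b then c else 1) = 1 + (c - 1) / ℓ := by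
    intro a
    have : ∀ b, (if a = b then c else 1) = 1 + (if a = b then (c - 1) else 0) := by
      intro b; split_ifs <;> ring
    simp only [this, Finset.expect_add_distrib, Fintype.expect_const]
    rw [Fintype.expect_eq_sum_div_card]
    simp
  have h2 : 𝔼 q : (Fin m → Fin ℓ) × (Fin m → Fin ℓ), ∏ j, (if q.1 j = q.2 j then c else 1) =
      (1 + (c - 1) / ℓ) ^ m := by
    rw [expect_prod_type]
    simp only
    have : ∀ s : Fin m → Fin ℓ, 𝔼 t : Fin m → Fin ℓ, ∏ j, (if s j = t j then c else 1) =
        (1 + (c - 1) / ℓ) ^ m := by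
      intro s
      rw [expect_prod_pi (fun j b => if s j = b then c else 1)]
      simp [h1]
    simp only [this, Fintype.expect_const]
  rw [Finset.prod_congr rfl fun i _ => h2]
  simp

lemma one_le_prod_aux {ι : Type*} (s : Finset ι) (f : ι → ℝ) (h : ∀ i ∈ s, 1 ≤ f i) :
    1 ≤ ∏ i ∈ s, f i := by
  calc (1 : ℝ) = ∏ i ∈ s, (1 : ℝ) := by simp
    _ ≤ _ := Finset.prod_le_prod (fun _ _ => zero_le_one) h

lemma tail_bound {K m ℓ d : ℕ} (hl : 0 < ℓ) (B : ℝ) (hB : 1 ≤ B) :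
    𝔼 Q : Fin K → (Fin m → Fin ℓ) × (Fin m → Fin ℓ),
      (if (badSet Q).card < d then 0 else B ^ (badSet Q).card) ≤
    (1 / 4) ^ d * ((1 + (4 * B - 1) / ℓ) ^ m) ^ K := by
  rw [← mgf hl, Finset.mul_expect]
  refine Finset.expect_le_expect fun Q _ => ?_
  have h1 : (4 * B) ^ (badSet Q).card ≤ ∏ i, ∏ j,
      (if (Q i).1 j = (Q i).2 j then 4 * B else 1) := by
    rw [Finset.prod_comm]
    have : (4 * B) ^ (badSet Q).card = ∏ j, (if j ∈ badSet Q then 4 * B else 1) := by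
      rw [Finset.prod_ite_mem, Finset.univ_inter, Finset.prod_const]
    rw [this]
    refine Finset.prod_le_prod (fun j _ => by split_ifs <;> linarith) fun j _ => ?_
    have hge : ∀ i ∈ univ, 1 ≤ (if (Q i).1 j = (Q i).2 j then 4 * B else 1) := by
      intro i _
      split_ifs <;> linarith
    split_ifs with hj
    · obtain ⟨i, hi⟩ := (Finset.mem_filter.1 hj).2
      rw [← Finset.mul_prod_erase univ _ (Finset.mem_univ i), if_pos hi]
      refine le_mul_of_one_le_right (by linarith) ?_
      exact one_le_prod_aux _ _ fun i _ => hge i (Finset.mem_univ _)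
    · exact one_le_prod_aux _ _ hge
  have h0 : 0 ≤ (4 * B) ^ (badSet Q).card := by positivity
  split_ifs with h
  · exact mul_nonneg (by positivity) (h0.trans h1)
  · refine le_trans ?_ (mul_le_mul_of_nonneg_left h1 (by positivity))
    rw [mul_pow, ← mul_assoc]
    refine le_mul_of_one_le_left (by positivity) ?_
    push Not at h
    rw [one_div, inv_pow, ← div_eq_inv_mul, one_le_div (by positivity)]
    exact pow_le_pow_right₀ (by norm_num) h

lemma bval_abs (b : Bool) : |bval b| ≤ 1 := by
  cases b <;> simp [bval]

lemma bval_forall {K : ℕ} (p : Fin K → Bool) :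
    bval (decide (∀ i, p i = true)) = ∏ i, bval (p i) := by
  unfold bval
  rw [Finset.prod_boole]
  simp

lemma numeric {K m ℓ d : ℕ} (hK : 1 ≤ K) (hd : 2 < d)
    (hℓ : (2 : ℝ) ^ (2 ^ (K + 1)) * K * Real.exp 1 * m / d ≤ (ℓ : ℝ) - 1) :
    (1 / 4 : ℝ) ^ d * ((1 + (4 * 2 ^ 2 ^ K - 1) / ℓ) ^ m) ^ K ≤ (1 / 2) ^ d := by
  have hd0 : (0 : ℝ) < d := by exact_mod_cast (by omega : 0 < d)
  have hl : (0 : ℝ) < ℓ := by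
    have : (0 : ℝ) ≤ (2 : ℝ) ^ (2 ^ (K + 1)) * K * Real.exp 1 * m / d := by positivity
    linarith
  set B : ℝ := 2 ^ 2 ^ K with hB
  have hB1 : 4 ≤ B := by
    calc (4 : ℝ) = 2 ^ 2 := by norm_num
      _ ≤ 2 ^ 2 ^ K := pow_le_pow_right₀ (by norm_num) (by
          calc 2 = 2 ^ 1 := by norm_num
            _ ≤ 2 ^ K := Nat.pow_le_pow_right (by norm_num) hK)
  have hBB : (2 : ℝ) ^ (2 ^ (K + 1)) = B * B := by
    rw [hB, ← pow_add, pow_succ, mul_two]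
  rw [hBB, div_le_iff₀ hd0] at hℓ
  have he : 2 ≤ Real.exp 1 := by
    have := Real.add_one_le_exp 1
    linarith
  have h1 : 1 + (4 * B - 1) / ℓ ≤ Real.exp ((4 * B) / ℓ) := by
    have h := Real.add_one_le_exp ((4 * B) / ℓ)
    have : (4 * B - 1) / ℓ ≤ 4 * B / ℓ := by gcongr; linarith
    linarith
  have h1' : 0 ≤ 1 + (4 * B - 1) / ℓ := by
    have : 0 ≤ (4 * B - 1) / ℓ := div_nonneg (by linarith) hl.le
    linarith
  have h2 : ((1 + (4 * B - 1) / ℓ) ^ m) ^ K ≤ Real.exp (d / 2) := by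
    rw [← pow_mul]
    refine (pow_le_pow_left₀ h1' h1 _).trans ?_
    rw [← Real.exp_nat_mul]
    apply Real.exp_le_exp.2
    rw [mul_div_assoc', div_le_iff₀ hl]
    push_cast
    have hmK : (0 : ℝ) ≤ m * K := by positivity
    have a1 : (m * K : ℝ) * (4 * B) ≤ m * K * (B * B) := by
      refine mul_le_mul_of_nonneg_left ?_ hmK
      exact mul_le_mul_of_nonneg_right hB1 (by linarith)
    have a2 : (m * K : ℝ) * (B * B) * 2 ≤ m * K * (B * B) * Real.exp 1 := by
      refine mul_le_mul_of_nonneg_left he (by positivity)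
    nlinarith
  have h3 : Real.exp (d / 2) ≤ 2 ^ d := by
    have : Real.exp (d / 2) = Real.exp (1 / 2) ^ d := by
      rw [← Real.exp_nat_mul]
      congr 1
      ring
    rw [this]
    refine pow_le_pow_left₀ (Real.exp_pos _).le ?_ d
    have h4 : Real.exp (1 / 2) * Real.exp (1 / 2) = Real.exp 1 := by
      rw [← Real.exp_add]; norm_num
    have h5 : Real.exp 1 < 3 := Real.exp_one_lt_three
    nlinarith [Real.exp_pos (1 / 2)]
  calc _ ≤ (1 / 4 : ℝ) ^ d * 2 ^ d :=
        mul_le_mul_of_nonneg_left (h2.trans h3) (by positivity)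
    _ = _ := by
        rw [← mul_pow]
        norm_num

/-- The sub-input of `x` selected by `S`. -/
def sel {K m ℓ : ℕ} (x : Fin m × (Fin K → Fin ℓ) → Bool) (S : Fin K → Fin m → Fin ℓ) :
    Fin m → Bool := fun j => x (j, fun i => S i j)

lemma expect_sel {K m ℓ : ℕ} (S : Fin K → Fin m → Fin ℓ) (f : (Fin m → Bool) → ℝ) :
    𝔼 x : Fin m × (Fin K → Fin ℓ) → Bool, 2 ^ m * f (sel x S) = ∑ z, f z := by
  have h := expect_comp_inj (P := Fin m × (Fin K → Fin ℓ)) (fun j : Fin m => (j, fun i => S i j))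
    (fun j j' h => congrArg Prod.fst h) (fun z => 2 ^ m * f z)
  refine Eq.trans h ?_
  rw [← Finset.mul_expect, Fintype.expect_eq_sum_div_card]
  simp
  field_simp

/-- The players' inputs encoding `(x, S)`. -/
def enc {K m ℓ n : ℕ} (e : Fin m × (Fin K → Fin ℓ) ≃ Fin n)
    (x : Fin m × (Fin K → Fin ℓ) → Bool) (S : Fin K → Fin m → Fin ℓ) :
    Fin (K + 1) → Fin n → Bool :=
  Fin.cons (fun a => x (e.symm a)) (fun i a => decide ((e.symm a).2 i = S i (e.symm a).1))

open Classical in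
/-- The block-wise OR of ANDs. -/
noncomputable def dec {K m ℓ n : ℕ} (e : Fin m × (Fin K → Fin ℓ) ≃ Fin n)
    (y : Fin (K + 1) → Fin n → Bool) : Fin m → Bool :=
  fun j => decide (∃ a, ∀ i, y i (e (j, a)) = true)

lemma dec_enc {K m ℓ n : ℕ} (e : Fin m × (Fin K → Fin ℓ) ≃ Fin n)
    (x : Fin m × (Fin K → Fin ℓ) → Bool) (S : Fin K → Fin m → Fin ℓ) :
    dec e (enc e x S) = sel x S := by
  funext j
  unfold dec enc sel
  rw [Bool.eq_iff_iff, decide_eq_true_iff]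
  simp only [Fin.forall_fin_succ, Fin.cons_zero, Fin.cons_succ, Equiv.symm_apply_apply,
    decide_eq_true_iff]
  constructor
  · rintro ⟨a, h1, h2⟩
    rw [← funext h2]
    exact h1
  · intro h
    exact ⟨_, h, fun i => rfl⟩

lemma disj_eq {K m ℓ n : ℕ} (e : Fin m × (Fin K → Fin ℓ) ≃ Fin n)
    (y : Fin (K + 1) → Fin n → Bool) : DISJ (K + 1) n y = NOR m (dec e y) := by
  have : (∃ j : Fin n, ∀ i, y i j = true) ↔ ¬ ∀ j, dec e y j = false := by
    unfold dec
    simp only [decide_eq_false_iff_not, not_forall, not_not]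
    constructor
    · rintro ⟨a, h⟩
      exact ⟨(e.symm a).1, (e.symm a).2, by simpa using h⟩
    · rintro ⟨j, a, h⟩
      exact ⟨_, h⟩
  unfold DISJ NOR
  by_cases h : ∀ j, dec e y j = false
  · rw [if_pos h, if_neg (by rw [this]; simpa using h)]
  · rw [if_neg h, if_pos (this.2 h)]

theorem main_disc {K m ℓ n d : ℕ} (hK : 1 ≤ K) (hd : 2 < d) (hl0 : 0 < ℓ)
    (hℓ : (2 : ℝ) ^ (2 ^ (K + 1)) * K * Real.exp 1 * m / d ≤ (ℓ : ℝ) - 1)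
    (e : Fin m × (Fin K → Fin ℓ) ≃ Fin n)
    (G : (Fin m → Bool) → ℝ) (hG1 : ∑ z, |G z| = 1)
    (hG : ∀ S : Finset (Fin m), S.card ≤ d - 1 → ∑ z, G z * chiChar S z = 0)
    (φ : (Fin (K + 1) → Fin n → Bool) → Bool) (hφ : IsCylinderIntersection φ) :
    |𝔼 S, 𝔼 x, 2 ^ m * G (sel x S) * bval (φ (enc e x S))| ≤
      (2 : ℝ) ^ (-(d : ℝ) / 2 ^ K) := by
  have : Nonempty (Fin ℓ) := ⟨⟨0, hl0⟩⟩
  obtain ⟨ψ, hψ, hφψ⟩ := hφ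
  set x0 : Fin m × (Fin K → Fin ℓ) → Bool := fun _ => false
  have h := bns (X := Fin m × (Fin K → Fin ℓ) → Bool) (T := Fin m → Fin ℓ) K
    (fun x S => 2 ^ m * G (sel x S)) (fun S => bval (ψ 0 (enc e x0 S)))
    (fun i x S => bval (ψ i.succ (enc e x S))) (fun S => bval_abs _) (fun i x S => bval_abs _) (by
      intro i x S S' hS
      refine congrArg bval (hψ i.succ _ _ fun j hj => ?_)
      induction j using Fin.cases with
      | zero => rfl
      | succ j =>
        have hj' : j ≠ i := fun h => hj (by rw [h])
        simp only [enc, Fin.cons_succ, hS j hj'])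
  have e1 : 𝔼 S, 𝔼 x, 2 ^ m * G (sel x S) * bval (φ (enc e x S)) =
      𝔼 S, 𝔼 x, 2 ^ m * G (sel x S) * bval (ψ 0 (enc e x0 S)) *
        ∏ i, bval (ψ (Fin.succ i) (enc e x S)) := by
    refine Finset.expect_congr rfl fun S _ => Finset.expect_congr rfl fun x _ => ?_
    rw [hφψ, bval_forall, Fin.prod_univ_succ]
    have : ψ 0 (enc e x S) = ψ 0 (enc e x0 S) := by
      refine hψ 0 _ _ fun j hj => ?_
      obtain ⟨j, rfl⟩ := Fin.exists_succ_eq.2 hj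
      rfl
    rw [this]
    ring
  rw [← e1] at h
  have h2 : |𝔼 S, 𝔼 x, 2 ^ m * G (sel x S) * bval (φ (enc e x S))| ^ 2 ^ K ≤ (1 / 2) ^ d := by
    refine h.trans (le_trans ?_ (numeric hK hd hℓ))
    refine le_trans ?_ (tail_bound hl0 (2 ^ 2 ^ K) (one_le_pow₀ (by norm_num)))
    refine Finset.expect_le_expect fun Q _ => ?_
    refine (pair_bound G hG1 hG Q).trans (le_of_eq ?_)
    have : (badSet Q).card ≤ d - 1 ↔ (badSet Q).card < d := by omega
    simp only [this]
  refine le_of_pow_le_pow_left₀ (n := 2 ^ K) (by positivity) (by positivity) (h2.trans (le_of_eq ?_))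
  rw [← Real.rpow_natCast ((2 : ℝ) ^ (-(d : ℝ) / 2 ^ K)), ← Real.rpow_mul (by norm_num)]
  push_cast
  rw [div_mul_cancel₀ _ (by positivity), Real.rpow_neg (by norm_num), Real.rpow_natCast]
  simp

/-- Discrepancy form of the Disjointness lower bound: with `d` the `1/3`-approximate
degree of `NOR_m` (assumed `> 2`), `ℓ - 1 ≥ 2^{2^k}(k-1)e·m/d` and `n = ℓ^{k-1}m`,
there exist a probability distribution `λ'` on `({0,1}^n)^k` and a function
`h : ({0,1}^n)^k → {-1,1}` with `Corr_{λ'}(DISJ_k, h) > 1/3` and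
`disc_{k,λ'}(h) ≤ 2^{-d/2^{k-1}}`. -/
theorem statement12 (k m : ℕ) (hk : 2 ≤ k) (hm : 1 ≤ m)
    (d : ℕ) (hdeg : d = approxDeg m (1 / 3) (NOR m)) (hd : 2 < d)
    (ℓ : ℕ) (hℓ : (2 : ℝ) ^ (2 ^ k) * (k - 1) * Real.exp 1 * m / d ≤ (ℓ : ℝ) - 1)
    (n : ℕ) (hn : n = ℓ ^ (k - 1) * m) :
    ∃ (lam : (Fin k → Fin n → Bool) → ℝ) (h : (Fin k → Fin n → Bool) → ℝ),
      IsProbDist lam ∧ (∀ y, h y = 1 ∨ h y = -1) ∧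
      (1 : ℝ) / 3 < (∑ y, lam y * DISJ k n y * h y) ∧
      disc lam h ≤ (2 : ℝ) ^ (-(d : ℝ) / 2 ^ (k - 1)) := by
  obtain ⟨K, rfl⟩ : ∃ K, k = K + 1 := ⟨k - 1, by omega⟩
  have hK : 1 ≤ K := by omega
  simp only [Nat.add_sub_cancel] at hn ⊢
  have hℓ' : (2 : ℝ) ^ (2 ^ (K + 1)) * K * Real.exp 1 * m / d ≤ (ℓ : ℝ) - 1 := by
    push_cast at hℓ
    simpa using hℓ
  have hl0 : 0 < ℓ := by
    have h1 : (0 : ℝ) ≤ (2 : ℝ) ^ (2 ^ (K + 1)) * K * Real.exp 1 * m / d := by positivity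
    have h2 : (0 : ℝ) < ℓ := by linarith
    exact_mod_cast h2
  have : Nonempty (Fin ℓ) := ⟨⟨0, hl0⟩⟩
  have e : Fin m × (Fin K → Fin ℓ) ≃ Fin n := Fintype.equivFinOfCardEq (by
    simp [hn, mul_comm])
  have hno : ¬ ∃ φ, DegLE m (d - 1) φ ∧ ∀ z, |NOR m z - φ z| ≤ 1 / 3 := by
    have hlt : d - 1 < approxDeg m (1 / 3) (NOR m) := by omega
    exact Nat.notMem_of_lt_sInf hlt
  obtain ⟨G, hG1, hG2, hG3⟩ := duality m (d - 1) (NOR m) (1 / 3) (by norm_num) hno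
  set g : (Fin m → Bool) → ℝ := fun z => if G z < 0 then -1 else 1 with hg
  have hgG : ∀ z, |G z| * g z = G z := by
    intro z
    simp only [hg]
    split_ifs with h
    · rw [abs_of_neg h]; ring
    · rw [abs_of_nonneg (not_lt.1 h), mul_one]
  set lam : (Fin (K + 1) → Fin n → Bool) → ℝ := fun y =>
    𝔼 S : Fin K → Fin m → Fin ℓ, 𝔼 x : Fin m × (Fin K → Fin ℓ) → Bool,
      2 ^ m * |G (sel x S)| * (if enc e x S = y then 1 else 0) with hlam
  have push : ∀ Φ : (Fin (K + 1) → Fin n → Bool) → ℝ, ∑ y, lam y * Φ y =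
      𝔼 S : Fin K → Fin m → Fin ℓ, 𝔼 x : Fin m × (Fin K → Fin ℓ) → Bool,
        2 ^ m * |G (sel x S)| * Φ (enc e x S) := by
    intro Φ
    simp only [hlam, Finset.expect_mul]
    rw [← Finset.expect_sum_comm]
    refine Finset.expect_congr rfl fun S _ => ?_
    rw [← Finset.expect_sum_comm]
    refine Finset.expect_congr rfl fun x _ => ?_
    simp
  refine ⟨lam, fun y => g (dec e y), ⟨fun y => ?_, ?_⟩, fun y => ?_, ?_, ?_⟩
  · refine Finset.expect_nonneg fun S _ => Finset.expect_nonneg fun x _ => ?_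
    split_ifs <;> positivity
  · have h := push (fun _ => 1)
    simp only [mul_one] at h
    rw [h]
    have h2 : ∀ S : Fin K → Fin m → Fin ℓ, 𝔼 x : Fin m × (Fin K → Fin ℓ) → Bool,
        2 ^ m * |G (sel x S)| = 1 := fun S => (expect_sel S (fun z => |G z|)).trans hG1
    simp only [h2, Fintype.expect_const]
  · simp only [hg]
    split_ifs
    · exact Or.inr rfl
    · exact Or.inl rfl
  · have h := push (fun y => DISJ (K + 1) n y * g (dec e y))
    simp only [← mul_assoc] at h
    rw [h]
    have h2 : ∀ S : Fin K → Fin m → Fin ℓ, 𝔼 x : Fin m × (Fin K → Fin ℓ) → Bool,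
        2 ^ m * |G (sel x S)| * DISJ (K + 1) n (enc e x S) * g (dec e (enc e x S)) =
        ∑ z, NOR m z * G z := by
      intro S
      rw [← expect_sel S (fun z => NOR m z * G z)]
      refine Finset.expect_congr rfl fun x _ => ?_
      rw [disj_eq e, dec_enc]
      nth_rewrite 2 [← hgG (sel x S)]
      ring
    simp only [h2, Fintype.expect_const]
    exact hG2
  · refine Real.sSup_le ?_ (by positivity)
    rintro t ⟨φ, hφ, rfl⟩
    refine le_of_eq_of_le ?_ (main_disc hK hd hl0 hℓ' e G hG1 hG3 φ hφ)
    have h := push (fun y => g (dec e y) * bval (φ y))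
    simp only [← mul_assoc] at h
    rw [h]
    congr 1
    refine Finset.expect_congr rfl fun S _ => Finset.expect_congr rfl fun x _ => ?_
    rw [dec_enc, mul_assoc (2 ^ m), hgG]
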